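/- Consider min ‖Ex‖⋆ + (α/2)‖x‖₂² subject to Ax = b, x ∈ 𝒞, where 𝒞 = {x : Cx ≤ d} and α > 0. The unique minimizer x*(b) is a continuous function of b on A𝒞 := {Ax : x ∈ 𝒞}. Moreover, when ‖Ex‖⋆ is replaced by an arbitrary convex piecewise affine function f(x), the unique minimizer of min_{x∈𝒞, Ax=b} f(x) + (α/2)‖x‖₂² is globally Lipschitz continuous in b on A𝒞. -/

import Mathlib

open Filter Topology

lemma aux_cone_bound {m N : ℕ} (A : Matrix (Fin m) (Fin N) ℝ) (Q : Set (Fin N → ℝ))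
    (hQ : IsClosed Q) (hc : ∀ t : ℝ, 0 < t → ∀ h ∈ Q, t • h ∈ Q)
    (hinj : ∀ h ∈ Q, A.mulVec h = 0 → h = 0) :
    ∃ c > (0 : ℝ), ∀ h ∈ Q, h ⬝ᵥ h ≤ c * (A.mulVec h ⬝ᵥ A.mulVec h) := by
  have hK : IsCompact (Q ∩ {h | h ⬝ᵥ h = 1}) := by
    refine Metric.isCompact_of_isClosed_isBounded ?_ ?_
    · exact hQ.inter (isClosed_eq (by fun_prop) (by fun_prop))
    · refine (Metric.isBounded_closedBall (x := (0 : Fin N → ℝ)) (r := 1)).subset ?_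
      rintro h ⟨-, h1⟩
      rw [mem_closedBall_zero_iff, pi_norm_le_iff_of_nonneg zero_le_one]
      intro i
      have h2 : h i * h i ≤ h ⬝ᵥ h :=
        Finset.single_le_sum (f := fun i => h i * h i) (fun j _ => mul_self_nonneg _) (Finset.mem_univ i)
      rw [Set.mem_setOf_eq] at h1
      rw [Real.norm_eq_abs, abs_le_one_iff_mul_self_le_one]
      linarith
  have hcont : Continuous fun h : Fin N → ℝ => A.mulVec h ⬝ᵥ A.mulVec h := by fun_prop
  have key : ∃ ε > (0 : ℝ), ∀ h ∈ Q ∩ {h | h ⬝ᵥ h = 1}, ε ≤ A.mulVec h ⬝ᵥ A.mulVec h := by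
    rcases (Q ∩ {h | h ⬝ᵥ h = 1}).eq_empty_or_nonempty with he | hne
    · exact ⟨1, one_pos, by simp [he]⟩
    · obtain ⟨h0, h0m, hmin⟩ := hK.exists_isMinOn hne hcont.continuousOn
      refine ⟨A.mulVec h0 ⬝ᵥ A.mulVec h0, ?_, fun h hh => hmin hh⟩
      have hnn : 0 ≤ A.mulVec h0 ⬝ᵥ A.mulVec h0 :=
        Finset.sum_nonneg fun i _ => mul_self_nonneg _
      refine lt_of_le_of_ne hnn fun h => ?_
      have := hinj h0 h0m.1 (dotProduct_self_eq_zero.1 h.symm)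
      have h1 := h0m.2
      simp [this] at h1
  obtain ⟨ε, hε, hb⟩ := key
  refine ⟨1 / ε, by positivity, fun h hh => ?_⟩
  have hnn : 0 ≤ h ⬝ᵥ h := Finset.sum_nonneg fun i _ => mul_self_nonneg _
  have hnn' : 0 ≤ A.mulVec h ⬝ᵥ A.mulVec h := Finset.sum_nonneg fun i _ => mul_self_nonneg _
  rcases hnn.eq_or_lt with h0 | hpos
  · rw [← h0]; positivity
  · set t := Real.sqrt (h ⬝ᵥ h) with ht
    have htp : 0 < t := Real.sqrt_pos.2 hpos
    have htt : t * t = h ⬝ᵥ h := Real.mul_self_sqrt hnn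
    have := hb (t⁻¹ • h) ⟨hc _ (by positivity) h hh, by
      simp only [Set.mem_setOf_eq, smul_dotProduct, dotProduct_smul, smul_eq_mul]
      rw [← htt]; field_simp⟩
    simp only [Matrix.mulVec_smul, smul_dotProduct, dotProduct_smul, smul_eq_mul] at this
    rw [← htt]
    have h3 : t⁻¹ * (t⁻¹ * (A.mulVec h ⬝ᵥ A.mulVec h)) * (t * t) = A.mulVec h ⬝ᵥ A.mulVec h := by
      field_simp
    have h4 := mul_le_mul_of_nonneg_right this (by positivity : 0 ≤ t * t)
    rw [h3] at h4
    rw [div_mul_eq_mul_div, one_mul, le_div_iff₀ hε]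
    linarith

lemma aux_dir {m N l s : ℕ} (α : ℝ) (hα : 0 < α)
    (A : Matrix (Fin m) (Fin N) ℝ) (C : Matrix (Fin l) (Fin N) ℝ) (d : Fin l → ℝ)
    (p : Fin s → Fin N → ℝ) (γ : Fin s → ℝ) (f : (Fin N → ℝ) → ℝ)
    (hle : ∀ x k, p k ⬝ᵥ x + γ k ≤ f x) (hex : ∀ x, ∃ k, p k ⬝ᵥ x + γ k = f x)
    (x : Fin N → ℝ) (hxC : ∀ i, C.mulVec x i ≤ d i)
    (hmin : ∀ y, (∀ i, C.mulVec y i ≤ d i) → A.mulVec y = A.mulVec x →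
      f x + α / 2 * (x ⬝ᵥ x) ≤ f y + α / 2 * (y ⬝ᵥ y))
    (w : Fin N → ℝ) (hAw : A.mulVec w = 0)
    (hCw : ∀ i, C.mulVec x i = d i → C.mulVec w i ≤ 0)
    (M : ℝ) (hM : ∀ k, p k ⬝ᵥ x + γ k = f x → p k ⬝ᵥ w ≤ M) :
    0 ≤ M + α * (x ⬝ᵥ w) := by
  have e1 : ∀ i, ∀ᶠ t in 𝓝[>] (0 : ℝ), C.mulVec x i + t * C.mulVec w i ≤ d i := by
    intro i
    rcases (hxC i).eq_or_lt with h | h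
    · filter_upwards [self_mem_nhdsWithin] with t ht
      have := mul_nonneg (le_of_lt ht) (neg_nonneg.2 (hCw i h))
      linarith
    · have ht : Tendsto (fun t : ℝ => C.mulVec x i + t * C.mulVec w i) (𝓝[>] 0)
          (𝓝 (C.mulVec x i + 0 * C.mulVec w i)) :=
        (Continuous.tendsto (by fun_prop) 0).mono_left nhdsWithin_le_nhds
      exact (ht.eventually (gt_mem_nhds (by simpa using h))).mono fun t h => le_of_lt h
  have e2 : ∀ k, ∀ᶠ t in 𝓝[>] (0 : ℝ), p k ⬝ᵥ x + t * (p k ⬝ᵥ w) + γ k ≤ f x + t * M := by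
    intro k
    rcases (hle x k).eq_or_lt with h | h
    · filter_upwards [self_mem_nhdsWithin] with t ht
      have := mul_le_mul_of_nonneg_left (hM k h) (le_of_lt ht)
      linarith
    · have ht : Tendsto (fun t : ℝ => p k ⬝ᵥ x + t * (p k ⬝ᵥ w) + γ k - t * M) (𝓝[>] 0)
          (𝓝 (p k ⬝ᵥ x + 0 * (p k ⬝ᵥ w) + γ k - 0 * M)) :=
        (Continuous.tendsto (by fun_prop) 0).mono_left nhdsWithin_le_nhds
      exact (ht.eventually (gt_mem_nhds (by simpa using h))).mono fun t h => by linarith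
  have e3 : ∀ᶠ t in 𝓝[>] (0 : ℝ), 0 ≤ M + α * (x ⬝ᵥ w) + α / 2 * t * (w ⬝ᵥ w) := by
    filter_upwards [eventually_all.2 e1, eventually_all.2 e2, self_mem_nhdsWithin] with t h1 h2 ht
    have ht : 0 < t := ht
    have := hmin (x + t • w) (fun i => by
      simpa [Matrix.mulVec_add, Matrix.mulVec_smul] using h1 i)
      (by simp [Matrix.mulVec_add, Matrix.mulVec_smul, hAw])
    obtain ⟨k, hk⟩ := hex (x + t • w)
    have hk2 := h2 k
    simp only [dotProduct_add, add_dotProduct, smul_dotProduct, dotProduct_smul, smul_eq_mul,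
      dotProduct_comm w x] at this hk
    have h5 : 0 ≤ t * (M + α * (x ⬝ᵥ w) + α / 2 * t * (w ⬝ᵥ w)) := by nlinarith
    exact nonneg_of_mul_nonneg_right h5 ht
  have ht : Tendsto (fun t : ℝ => M + α * (x ⬝ᵥ w) + α / 2 * t * (w ⬝ᵥ w)) (𝓝[>] 0)
          (𝓝 (M + α * (x ⬝ᵥ w) + α / 2 * 0 * (w ⬝ᵥ w))) :=
        (Continuous.tendsto (by fun_prop) 0).mono_left nhdsWithin_le_nhds
  have := ge_of_tendsto ht e3
  simpa using this

def auxP {N l s : ℕ} (C : Matrix (Fin l) (Fin N) ℝ) (p : Fin s → Fin N → ℝ)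
    (q : (Set (Fin l) × Set (Fin l)) × (Set (Fin s) × Set (Fin s))) : Set (Fin N → ℝ) :=
  {h | (∀ i ∈ q.1.1, C.mulVec h i ≤ 0) ∧ (∀ i ∈ q.1.2, 0 ≤ C.mulVec h i) ∧
    ∀ k ∈ q.2.1, ∀ k' ∈ q.2.2, p k ⬝ᵥ h ≤ p k' ⬝ᵥ h}

def auxQ {m N l s : ℕ} (A : Matrix (Fin m) (Fin N) ℝ) (C : Matrix (Fin l) (Fin N) ℝ)
    (p : Fin s → Fin N → ℝ)
    (q : (Set (Fin l) × Set (Fin l)) × (Set (Fin s) × Set (Fin s))) : Set (Fin N → ℝ) :=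
  auxP C p q ∩ {h | ∀ v, A.mulVec v = 0 → v ∈ auxP C p q → h ⬝ᵥ v ≤ 0}

lemma auxQ_bound {m N l s : ℕ} (A : Matrix (Fin m) (Fin N) ℝ) (C : Matrix (Fin l) (Fin N) ℝ)
    (p : Fin s → Fin N → ℝ)
    (q : (Set (Fin l) × Set (Fin l)) × (Set (Fin s) × Set (Fin s))) :
    ∃ c > (0 : ℝ), ∀ h ∈ auxQ A C p q, h ⬝ᵥ h ≤ c * (A.mulVec h ⬝ᵥ A.mulVec h) := by
  apply aux_cone_bound
  · refine IsClosed.inter ?_ ?_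
    · simp only [auxP, Set.setOf_and, Set.setOf_forall]
      refine IsClosed.inter ?_ (IsClosed.inter ?_ ?_)
      · exact isClosed_iInter fun i => isClosed_iInter fun _ =>
          isClosed_le (by fun_prop) (by fun_prop)
      · exact isClosed_iInter fun i => isClosed_iInter fun _ =>
          isClosed_le (by fun_prop) (by fun_prop)
      · exact isClosed_iInter fun i => isClosed_iInter fun _ => isClosed_iInter fun _ =>
          isClosed_iInter fun _ => isClosed_le (by fun_prop) (by fun_prop)
    · simp only [Set.setOf_forall]
      exact isClosed_iInter fun i => isClosed_iInter fun _ => isClosed_iInter fun _ =>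
          isClosed_le (by fun_prop) (by fun_prop)
  · rintro t ht h ⟨⟨h1, h2, h3⟩, h4⟩
    refine ⟨⟨fun i hi => ?_, fun i hi => ?_, fun k hk k' hk' => ?_⟩, fun v hv hv' => ?_⟩
    · simpa [Matrix.mulVec_smul] using mul_nonpos_of_nonneg_of_nonpos ht.le (h1 i hi)
    · simpa [Matrix.mulVec_smul] using mul_nonneg ht.le (h2 i hi)
    · simpa [dotProduct_smul] using mul_le_mul_of_nonneg_left (h3 k hk k' hk') ht.le
    · simpa [smul_dotProduct] using mul_nonpos_of_nonneg_of_nonpos ht.le (h4 v hv hv')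
  · rintro h ⟨h1, h2⟩ h3
    have h4 := h2 h h3 h1
    have hnn : 0 ≤ h ⬝ᵥ h := Finset.sum_nonneg fun i _ => mul_self_nonneg _
    exact dotProduct_self_eq_zero.1 (le_antisymm h4 hnn)

lemma aux_lip {m N l s : ℕ} (α : ℝ) (hα : 0 < α)
    (A : Matrix (Fin m) (Fin N) ℝ) (C : Matrix (Fin l) (Fin N) ℝ) (d : Fin l → ℝ)
    (p : Fin s → Fin N → ℝ) (γ : Fin s → ℝ) (f : (Fin N → ℝ) → ℝ)
    (hle : ∀ x k, p k ⬝ᵥ x + γ k ≤ f x) (hex : ∀ x, ∃ k, p k ⬝ᵥ x + γ k = f x) :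
    ∃ c > (0 : ℝ), ∀ x x', (∀ i, C.mulVec x i ≤ d i) → (∀ i, C.mulVec x' i ≤ d i) →
    (∀ y, (∀ i, C.mulVec y i ≤ d i) → A.mulVec y = A.mulVec x →
      f x + α / 2 * (x ⬝ᵥ x) ≤ f y + α / 2 * (y ⬝ᵥ y)) →
    (∀ y, (∀ i, C.mulVec y i ≤ d i) → A.mulVec y = A.mulVec x' →
      f x' + α / 2 * (x' ⬝ᵥ x') ≤ f y + α / 2 * (y ⬝ᵥ y)) →
    (x' - x) ⬝ᵥ (x' - x) ≤ c * ((A.mulVec x' - A.mulVec x) ⬝ᵥ (A.mulVec x' - A.mulVec x)) := by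
  choose c hc hb using auxQ_bound A C p
  obtain ⟨B, hB⟩ := (Set.finite_range c).bddAbove
  have hB' : ∀ q, c q ≤ B := fun q => hB ⟨q, rfl⟩
  refine ⟨max B 1, by positivity, fun x x' hx hx' hm hm' => ?_⟩
  rw [← Matrix.mulVec_sub]
  set q : (Set (Fin l) × Set (Fin l)) × (Set (Fin s) × Set (Fin s)) :=
    (({i | C.mulVec x i = d i}, {i | C.mulVec x' i = d i}),
     ({k | p k ⬝ᵥ x + γ k = f x}, {k | p k ⬝ᵥ x' + γ k = f x'})) with hq
  have hmem : x' - x ∈ auxQ A C p q := by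
    refine ⟨⟨fun i hi => ?_, fun i hi => ?_, fun k hk k' hk' => ?_⟩, fun v hv hv' => ?_⟩
    · have hi : C.mulVec x i = d i := hi
      have := hx' i
      simp only [Matrix.mulVec_sub, Pi.sub_apply]; linarith
    · have hi : C.mulVec x' i = d i := hi
      have := hx i
      simp only [Matrix.mulVec_sub, Pi.sub_apply]; linarith
    · have hk : p k ⬝ᵥ x + γ k = f x := hk
      have hk' : p k' ⬝ᵥ x' + γ k' = f x' := hk'
      have h1 := hle x' k
      have h2 := hle x k'
      simp only [dotProduct_sub]; linarith
    · obtain ⟨v1, v2, v3⟩ := hv'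
      obtain ⟨k0, hk0, hmax⟩ := Set.exists_max_image {k | p k ⬝ᵥ x + γ k = f x}
        (fun k => p k ⬝ᵥ v) (Set.toFinite _) (hex x)
      have a1 := aux_dir α hα A C d p γ f hle hex x hx hm v hv v1 (p k0 ⬝ᵥ v)
        (fun k hk => hmax k hk)
      have a2 := aux_dir α hα A C d p γ f hle hex x' hx' hm' (-v)
        (by rw [Matrix.mulVec_neg, hv, neg_zero])
        (fun i hi => by
          have := v2 i hi
          simp only [Matrix.mulVec_neg, Pi.neg_apply]; linarith) (-(p k0 ⬝ᵥ v))
        (fun k hk => by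
          have := v3 k0 hk0 k hk
          simp only [dotProduct_neg]; linarith)
      simp only [dotProduct_neg] at a2
      rw [sub_dotProduct]
      have h5 : 0 ≤ α * (x ⬝ᵥ v - x' ⬝ᵥ v) := by linarith
      have := nonneg_of_mul_nonneg_right h5 hα
      linarith
  refine (hb q _ hmem).trans (mul_le_mul_of_nonneg_right ((hB' q).trans (le_max_left _ _)) ?_)
  exact Finset.sum_nonneg fun i _ => mul_self_nonneg _

/-- lower semicontinuity of the feasible set -/
lemma aux_lsc {m N l : ℕ}
    (A : Matrix (Fin m) (Fin N) ℝ) (C : Matrix (Fin l) (Fin N) ℝ) (d : Fin l → ℝ)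
    (x0 : Fin N → ℝ) (hx0 : ∀ i, C.mulVec x0 i ≤ d i) :
    ∃ c > (0 : ℝ), ∀ x, (∀ i, C.mulVec x i ≤ d i) → ∃ y, (∀ i, C.mulVec y i ≤ d i) ∧
      A.mulVec y = A.mulVec x ∧
      (y - x0) ⬝ᵥ (y - x0) ≤ c * ((A.mulVec x - A.mulVec x0) ⬝ᵥ (A.mulVec x - A.mulVec x0)) := by
  obtain ⟨c, hc, h⟩ := aux_lip 1 one_pos A C d (fun _ : Fin 1 => -x0) (fun _ => 0)
    (fun x => -(x0 ⬝ᵥ x)) (fun x k => by simp) (fun x => ⟨0, by simp⟩)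
  refine ⟨c, hc, fun x hx => ?_⟩
  have hsq : ∀ y : Fin N → ℝ, -(x0 ⬝ᵥ y) + 1 / 2 * (y ⬝ᵥ y) =
      1 / 2 * ((y - x0) ⬝ᵥ (y - x0)) - 1 / 2 * (x0 ⬝ᵥ x0) := by
    intro y
    simp only [dotProduct_sub, sub_dotProduct, dotProduct_comm y x0]; ring
  have hK : IsCompact ({y | ∀ i, C.mulVec y i ≤ d i} ∩ {y | A.mulVec y = A.mulVec x} ∩
      {y | (y - x0) ⬝ᵥ (y - x0) ≤ (x - x0) ⬝ᵥ (x - x0)}) := by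
    refine Metric.isCompact_of_isClosed_isBounded ?_ ?_
    · refine (IsClosed.inter ?_ ?_).inter ?_
      · simp only [Set.setOf_forall]
        exact isClosed_iInter fun i => isClosed_le (by fun_prop) (by fun_prop)
      · exact isClosed_eq (by fun_prop) (by fun_prop)
      · exact isClosed_le (by fun_prop) (by fun_prop)
    · refine (Metric.isBounded_closedBall (x := x0)
        (r := Real.sqrt ((x - x0) ⬝ᵥ (x - x0)))).subset ?_
      rintro y ⟨-, h1⟩
      rw [Metric.mem_closedBall, dist_eq_norm, pi_norm_le_iff_of_nonneg (Real.sqrt_nonneg _)]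
      intro i
      have h2 : (y - x0) i * (y - x0) i ≤ (y - x0) ⬝ᵥ (y - x0) :=
        Finset.single_le_sum (f := fun i => (y - x0) i * (y - x0) i)
          (fun j _ => mul_self_nonneg _) (Finset.mem_univ i)
      rw [Real.norm_eq_abs]
      apply Real.abs_le_sqrt
      rw [Set.mem_setOf_eq] at h1
      nlinarith
  have hcont : Continuous fun y : Fin N → ℝ => (y - x0) ⬝ᵥ (y - x0) := by fun_prop
  obtain ⟨y, ⟨⟨hy1, hy2⟩, hy3⟩, hmin⟩ := hK.exists_isMinOn ⟨x, ⟨hx, rfl⟩, le_refl ((x - x0) ⬝ᵥ (x - x0))⟩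
    hcont.continuousOn
  have hy2 : A.mulVec y = A.mulVec x := hy2
  refine ⟨y, hy1, hy2, ?_⟩
  rw [← hy2]
  refine h x0 y hx0 hy1 (fun z _ _ => ?_) (fun z hz1 hz2 => ?_)
  · rw [hsq, hsq]
    have hnn : 0 ≤ (z - x0) ⬝ᵥ (z - x0) := Finset.sum_nonneg fun i _ => mul_self_nonneg _
    simp only [sub_self, dotProduct_zero]
    linarith
  · rw [hsq, hsq]
    rcases le_total ((z - x0) ⬝ᵥ (z - x0)) ((x - x0) ⬝ᵥ (x - x0)) with h6 | h6
    · have : (y - x0) ⬝ᵥ (y - x0) ≤ (z - x0) ⬝ᵥ (z - x0) :=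
        hmin ⟨⟨hz1, hz2.trans hy2⟩, h6⟩
      linarith
    · have : (y - x0) ⬝ᵥ (y - x0) ≤ (x - x0) ⬝ᵥ (x - x0) := hy3
      linarith

lemma aux_cont {m N l : ℕ} (α : ℝ) (hα : 0 < α)
    (A : Matrix (Fin m) (Fin N) ℝ) (C : Matrix (Fin l) (Fin N) ℝ) (d : Fin l → ℝ)
    (g : (Fin N → ℝ) → ℝ) (hg : ConvexOn ℝ Set.univ g) (hg0 : ∀ x, 0 ≤ g x)
    (S : Set (Fin m → ℝ)) (X : (Fin m → ℝ) → (Fin N → ℝ))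
    (hX : ∀ b ∈ S, (∀ i, C.mulVec (X b) i ≤ d i) ∧ A.mulVec (X b) = b ∧
      ∀ y, (∀ i, C.mulVec y i ≤ d i) → A.mulVec y = b →
        g (X b) + α / 2 * (X b ⬝ᵥ X b) ≤ g y + α / 2 * (y ⬝ᵥ y)) :
    ContinuousOn X S := by
  have hgc : Continuous g := by
    rw [← continuousOn_univ]
    exact hg.continuousOn isOpen_univ
  intro b0 hb0
  obtain ⟨h1, h2, h3⟩ := hX b0 hb0
  obtain ⟨c, hc, hlsc⟩ := aux_lsc A C d (X b0) h1
  have hY : ∀ b, ∃ y, b ∈ S → (∀ i, C.mulVec y i ≤ d i) ∧ A.mulVec y = b ∧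
      (y - X b0) ⬝ᵥ (y - X b0) ≤ c * ((b - b0) ⬝ᵥ (b - b0)) := by
    intro b
    by_cases hb : b ∈ S
    · obtain ⟨y, hy⟩ := hlsc (X b) (hX b hb).1
      rw [(hX b hb).2.1, h2] at hy
      exact ⟨y, fun _ => hy⟩
    · exact ⟨0, fun h => absurd h hb⟩
  choose Y hYp using hY
  have hYt : Tendsto Y (𝓝[S] b0) (𝓝 (X b0)) := by
    have ht : Tendsto (fun b => Real.sqrt (c * ((b - b0) ⬝ᵥ (b - b0)))) (𝓝[S] b0) (𝓝 0) := by
      have : Continuous (fun b : Fin m → ℝ => Real.sqrt (c * ((b - b0) ⬝ᵥ (b - b0)))) := by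
        fun_prop
      simpa using (this.tendsto b0).mono_left nhdsWithin_le_nhds
    rw [tendsto_iff_norm_sub_tendsto_zero]
    refine squeeze_zero' (Eventually.of_forall fun _ => norm_nonneg _) ?_ ht
    filter_upwards [self_mem_nhdsWithin] with b hb
    rw [pi_norm_le_iff_of_nonneg (Real.sqrt_nonneg _)]
    intro i
    have h2 : (Y b - X b0) i * (Y b - X b0) i ≤ (Y b - X b0) ⬝ᵥ (Y b - X b0) :=
        Finset.single_le_sum (f := fun i => (Y b - X b0) i * (Y b - X b0) i)
          (fun j _ => mul_self_nonneg _) (Finset.mem_univ i)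
    rw [Real.norm_eq_abs]
    apply Real.abs_le_sqrt
    have := (hYp b hb).2.2
    nlinarith
  set J : (Fin N → ℝ) → ℝ := fun x => g x + α / 2 * (x ⬝ᵥ x) with hJ
  have hJc : Continuous J := by fun_prop
  have hJY : Tendsto (fun b => J (Y b)) (𝓝[S] b0) (𝓝 (J (X b0))) :=
    (hJc.tendsto _).comp hYt
  have hle : ∀ b ∈ S, J (X b) ≤ J (Y b) := fun b hb =>
    (hX b hb).2.2 _ (hYp b hb).1 (hYp b hb).2.1
  set R : ℝ := Real.sqrt (2 / α * (J (X b0) + 1)) with hR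
  have hbd : ∀ᶠ b in 𝓝[S] b0, X b ∈ Metric.closedBall (0 : Fin N → ℝ) R := by
    filter_upwards [self_mem_nhdsWithin,
      hJY.eventually (gt_mem_nhds (lt_add_one (J (X b0))))] with b hb hlt
    rw [mem_closedBall_zero_iff, pi_norm_le_iff_of_nonneg (Real.sqrt_nonneg _)]
    intro i
    have h4 : X b i * X b i ≤ X b ⬝ᵥ X b :=
        Finset.single_le_sum (f := fun i => X b i * X b i)
          (fun j _ => mul_self_nonneg _) (Finset.mem_univ i)
    rw [Real.norm_eq_abs]
    apply Real.abs_le_sqrt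
    have h5 := hle b hb
    have h6 : α / 2 * (X b ⬝ᵥ X b) ≤ J (X b0) + 1 := by
      have := hg0 (X b)
      simp only [hJ] at h5 hlt ⊢
      linarith
    have h7 : X b ⬝ᵥ X b = 2 / α * (α / 2 * (X b ⬝ᵥ X b)) := by field_simp
    have h8 := mul_le_mul_of_nonneg_left h6 (by positivity : 0 ≤ 2 / α)
    nlinarith
  rw [ContinuousWithinAt, tendsto_iff_ultrafilter]
  intro u hu
  have hK := isCompact_closedBall (0 : Fin N → ℝ) R
  obtain ⟨z, -, hz⟩ := isCompact_iff_ultrafilter_le_nhds.1 hK (u.map X)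
    (by rw [Ultrafilter.coe_map, le_principal_iff]; exact hu hbd)
  have hz : Tendsto X u (𝓝 z) := hz
  have huS : ∀ᶠ b in (u : Filter (Fin m → ℝ)), b ∈ S := hu self_mem_nhdsWithin
  have hub : Tendsto (fun b => b) (u : Filter (Fin m → ℝ)) (𝓝 b0) :=
    hu.trans nhdsWithin_le_nhds
  have z1 : ∀ i, C.mulVec z i ≤ d i := by
    intro i
    have hcont : Continuous fun x : Fin N → ℝ => C.mulVec x i := by fun_prop
    exact le_of_tendsto ((hcont.tendsto z).comp hz) (huS.mono fun b hb => (hX b hb).1 i)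
  have z2 : A.mulVec z = b0 := by
    have hcont : Continuous fun x : Fin N → ℝ => A.mulVec x := by fun_prop
    have h5 : Tendsto (fun b => b) (u : Filter (Fin m → ℝ)) (𝓝 (A.mulVec z)) :=
      ((hcont.tendsto z).comp hz).congr' (huS.mono fun b hb => (hX b hb).2.1)
    exact tendsto_nhds_unique h5 hub
  have z3 : J z ≤ J (X b0) :=
    le_of_tendsto_of_tendsto ((hJc.tendsto z).comp hz) (hJY.mono_left hu)
      (huS.mono fun b hb => hle b hb)
  have hzeq : z = X b0 := by
    have hconv := hg.2 (Set.mem_univ z) (Set.mem_univ (X b0)) (by norm_num : (0 : ℝ) ≤ 1 / 2)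
      (by norm_num : (0 : ℝ) ≤ 1 / 2) (by norm_num)
    have hm := h3 ((1 / 2 : ℝ) • z + (1 / 2 : ℝ) • X b0) (fun i => by
        have := h1 i
        have := z1 i
        simp only [Matrix.mulVec_add, Matrix.mulVec_smul, Pi.add_apply, Pi.smul_apply, smul_eq_mul]
        linarith) (by
        rw [Matrix.mulVec_add, Matrix.mulVec_smul, Matrix.mulVec_smul, z2, h2, ← add_smul]
        norm_num)
    simp only [dotProduct_add, add_dotProduct, smul_dotProduct, dotProduct_smul, smul_eq_mul,
      dotProduct_comm z (X b0)] at hm hconv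
    simp only [hJ] at z3
    have hnn : 0 ≤ (z - X b0) ⬝ᵥ (z - X b0) := Finset.sum_nonneg fun i _ => mul_self_nonneg _
    have h0 : (z - X b0) ⬝ᵥ (z - X b0) = 0 := by
      refine le_antisymm ?_ hnn
      have h9 : α * ((z - X b0) ⬝ᵥ (z - X b0)) ≤ 0 := by
        simp only [dotProduct_sub, sub_dotProduct, dotProduct_comm z (X b0)]
        linarith
      by_contra hcon
      push Not at hcon
      have := mul_pos hα hcon
      linarith
    exact sub_eq_zero.1 (dotProduct_self_eq_zero.1 h0)
  rw [← hzeq]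
  exact hz


/-- Sensitivity of the regularized BP-like problem in `b`. Part 1: for a norm
objective `‖Ex‖⋆ + (α/2)‖x‖₂²` over `{x ∈ 𝒞 : Ax = b}`, the (unique) minimizer
map `b ↦ x*(b)` is continuous on `A𝒞`. Part 2: when the norm term is replaced
by an arbitrary convex piecewise affine function `f`, the minimizer map is
globally Lipschitz on `A𝒞`. -/
theorem stmt19 {m N r ℓc s : ℕ}
    (nstar : (Fin r → ℝ) → ℝ)
    (hns1 : ∀ u v, nstar (u + v) ≤ nstar u + nstar v)
    (hns2 : ∀ (c : ℝ) u, nstar (c • u) = |c| * nstar u)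
    (hns3 : ∀ u, nstar u = 0 → u = 0)
    (α : ℝ) (hα : 0 < α)
    (A : Matrix (Fin m) (Fin N) ℝ) (E : Matrix (Fin r) (Fin N) ℝ)
    (Cm : Matrix (Fin ℓc) (Fin N) ℝ) (d : Fin ℓc → ℝ)
    (𝒞 : Set (Fin N → ℝ)) (h𝒞 : 𝒞 = {x | ∀ i, Cm.mulVec x i ≤ d i})
    (A𝒞 : Set (Fin m → ℝ)) (hA𝒞 : A𝒞 = {b | ∃ x ∈ 𝒞, A.mulVec x = b})
    (J : (Fin N → ℝ) → ℝ)
    (hJ : J = fun x => nstar (E.mulVec x) + α / 2 * ∑ j, (x j) ^ 2)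
    (xstar : (Fin m → ℝ) → (Fin N → ℝ))
    (hxstar : ∀ b ∈ A𝒞, xstar b ∈ 𝒞 ∧ A.mulVec (xstar b) = b ∧
      ∀ y ∈ 𝒞, A.mulVec y = b → J (xstar b) ≤ J y)
    (p : Fin (s + 1) → Fin N → ℝ) (γ : Fin (s + 1) → ℝ)
    (f : (Fin N → ℝ) → ℝ)
    (hf : ∀ x, f x = Finset.univ.sup' Finset.univ_nonempty
      (fun i => (∑ j, p i j * x j) + γ i))
    (G : (Fin N → ℝ) → ℝ)
    (hG : G = fun x => f x + α / 2 * ∑ j, (x j) ^ 2)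
    (xstarf : (Fin m → ℝ) → (Fin N → ℝ))
    (hxstarf : ∀ b ∈ A𝒞, xstarf b ∈ 𝒞 ∧ A.mulVec (xstarf b) = b ∧
      ∀ y ∈ 𝒞, A.mulVec y = b → G (xstarf b) ≤ G y) :
    ContinuousOn xstar A𝒞 ∧
    ∃ L > (0 : ℝ), ∀ b ∈ A𝒞, ∀ b' ∈ A𝒞,
      Real.sqrt (∑ j, (xstarf b j - xstarf b' j) ^ 2) ≤
        L * Real.sqrt (∑ i, (b i - b' i) ^ 2) := by

  subst h𝒞 hA𝒞 hJ hG
  have hsum : ∀ {n : ℕ} (x : Fin n → ℝ), ∑ j, (x j) ^ 2 = x ⬝ᵥ x := fun {_} x =>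
    Finset.sum_congr rfl fun j _ => pow_two _
  constructor
  · have hn0 : ∀ u, 0 ≤ nstar u := by
      intro u
      have a := hns1 u ((-1 : ℝ) • u)
      have b := hns2 (-1) u
      have c := hns2 0 u
      rw [b] at a
      simp at a c
      rw [c] at a
      linarith
    refine aux_cont α hα A Cm d (fun x => nstar (E.mulVec x)) ⟨convex_univ, ?_⟩
      (fun x => hn0 _) _ xstar ?_
    · intro x _ y _ a b ha hb _
      simp only [Matrix.mulVec_add, Matrix.mulVec_smul, smul_eq_mul]
      refine (hns1 _ _).trans ?_
      rw [hns2, hns2, abs_of_nonneg ha, abs_of_nonneg hb]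
    · intro b hb
      obtain ⟨h1, h2, h3⟩ := hxstar b hb
      refine ⟨h1, h2, fun y hy1 hy2 => ?_⟩
      have := h3 y hy1 hy2
      simpa only [hsum] using this
  · have hle : ∀ x k, p k ⬝ᵥ x + γ k ≤ f x := by
      intro x k
      rw [hf]
      exact Finset.le_sup' (fun i => (∑ j, p i j * x j) + γ i) (Finset.mem_univ k)
    have hex : ∀ x, ∃ k, p k ⬝ᵥ x + γ k = f x := by
      intro x
      obtain ⟨k, -, hk⟩ := Finset.exists_mem_eq_sup' Finset.univ_nonempty
        (fun i => (∑ j, p i j * x j) + γ i)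
      exact ⟨k, by rw [hf, hk]; rfl⟩
    obtain ⟨c, hc, hb⟩ := aux_lip α hα A Cm d p γ f hle hex
    refine ⟨Real.sqrt c, Real.sqrt_pos.2 hc, fun b hbm b' hbm' => ?_⟩
    obtain ⟨h1, h2, h3⟩ := hxstarf b hbm
    obtain ⟨h1', h2', h3'⟩ := hxstarf b' hbm'
    rw [← Real.sqrt_mul hc.le]
    apply Real.sqrt_le_sqrt
    have := hb (xstarf b') (xstarf b) h1' h1
      (fun y hy1 hy2 => by
        have := h3' y hy1 (hy2.trans h2')
        simpa only [hsum] using this)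
      (fun y hy1 hy2 => by
        have := h3 y hy1 (hy2.trans h2)
        simpa only [hsum] using this)
    rw [h2, h2', ← hsum, ← hsum] at this
    exact this
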